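/- Let F : A → B and G : B → A be functors between abelian categories with F left adjoint to G. Fix n ≥ 0, A ∈ A, B ∈ B. Assume (1) F maps every exact sequence 0 → GB → D_1 → ⋯ → D_n → A → 0 in A to an exact sequence 0 → FGB → FD_1 → ⋯ → FD_n → FA → 0, and (2) G maps every exact sequence 0 → B → E_1 → ⋯ → E_n → FA → 0 in B to an exact sequence 0 → GB → GE_1 → ⋯ → GE_n → GFA → 0. Then there is an isomorphism of abelian groups Ext^n_B(FA, B) ≅ Ext^n_A(A, GB). -/

import Mathlib

open CategoryTheory Limits

universe w₁ w₂ v₁ v₂ u₁ u₂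

variable {A' : Type u₁} [Category.{v₁} A'] {B' : Type u₂} [Category.{v₂} B']

/-- `S : ComposableArrows C (n+1)` (objects `X_0, …, X_{n+1}`) is "exact with zeros added",
i.e. `0 → X_0 → X_1 → ⋯ → X_{n+1} → 0` is exact: the first map is mono, the last map is
epi, and the sequence is exact at the interior objects. -/
def ExactWithZeros {C : Type u₁} [Category.{v₁} C] [Abelian C] {n : ℕ}
    (S : ComposableArrows C (n + 1)) : Prop :=
  S.Exact ∧ Mono (S.map' 0 1) ∧ Epi (S.map' n (n + 1))


namespace AdjExt
universe w w' v u

section efface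
open HomologicalComplex DerivedCategory Abelian Abelian.Ext
variable {C : Type u} [Category.{v} C] [Abelian C]

lemma epi_of_qis {X : C} {K : CochainComplex C ℤ} {i : ℤ}
    (π : K ⟶ (HomologicalComplex.single C (ComplexShape.up ℤ) i).obj X) [K.IsStrictlyLE i] [QuasiIsoAt π i] :
    ∃ (α : K.X i ⟶ X), Epi α ∧ π.f i = α ≫ (singleObjXSelf (ComplexShape.up ℤ) i X).inv := by
  let e := K.iCyclesIso i (i + 1) (by simp)
    ((K.isZero_of_isStrictlyLE i (i + 1) (by simp)).eq_of_tgt _ _)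
  let α := e.inv ≫ K.homologyπ i ≫ homologyMap π i ≫ (singleObjHomologySelfIso _ _ _).hom
  refine ⟨α, ?_, ?_⟩
  · have : IsIso (homologyMap π i) := by
      rwa [← quasiIsoAt_iff_isIso_homologyMap]
    have := epi_comp (homologyMap π i) (singleObjHomologySelfIso (ComplexShape.up ℤ) i X).hom
    have := epi_comp (K.homologyπ i) (homologyMap π i ≫ (singleObjHomologySelfIso _ _ _).hom)
    exact epi_comp _ _
  · rw [← cancel_epi e.hom]
    dsimp [α, e]
    rw [Category.assoc, Category.assoc, Category.assoc, Iso.hom_inv_id_assoc, iCyclesIso_hom,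
      homologyπ_naturality_assoc]
    rw [homologyπ_singleObjHomologySelfIso_hom_assoc,
      ← singleObjCyclesSelfIso_inv_iCycles, Iso.hom_inv_id_assoc, ← cyclesMap_i]

lemma efface_Q [HasDerivedCategory.{w} C] {X : C}
    {L : CochainComplex C ℤ} {i : ℤ}
    (φ : Q.obj ((CochainComplex.singleFunctor C i).obj X) ⟶ Q.obj L)
    (n : ℤ) (hn : n < i) [L.IsStrictlyLE n] :
    ∃ (P : C) (p : P ⟶ X), Epi p ∧ Q.map ((CochainComplex.singleFunctor C i).map p) ≫ φ = 0 := by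
  obtain ⟨K, _, π, h, g, rfl⟩ := right_fac_of_isStrictlyLE φ i
  have h' := h
  rw [isIso_Q_map_iff_quasiIso] at h'
  have h'' : QuasiIsoAt π i := inferInstance
  obtain ⟨α, hα, hπ⟩ := @epi_of_qis C _ _ X K i π _ h''
  refine ⟨_, α, hα, ?_⟩
  let s : (CochainComplex.singleFunctor C i).obj (K.X i) ⟶ K :=
    mkHomFromSingle (𝟙 _) (by
      rintro _ rfl
      apply (K.isZero_of_isStrictlyLE i (i + 1) (by simp)).eq_of_tgt)
  have h1 : (CochainComplex.singleFunctor C i).map α = s ≫ π := by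
    apply HomologicalComplex.from_single_hom_ext
    rw [comp_f, hπ, mkHomFromSingle_f]
    dsimp [CochainComplex.singleFunctor, CochainComplex.singleFunctors]
    simp [single_map_f_self]
  have h2 : s ≫ g = 0 := by
    apply HomologicalComplex.from_single_hom_ext
    apply (L.isZero_of_isStrictlyLE n i hn).eq_of_tgt
  rw [h1, Q.map_comp, Category.assoc, IsIso.hom_inv_id_assoc, ← Q.map_comp, h2, Q.map_zero]

lemma efface [HasExt.{w} C] {X Y : C} {n : ℕ} (e : Ext X Y (n + 1)) :
    ∃ (P : C) (p : P ⟶ X), Epi p ∧ (mk₀ p).comp e (zero_add _) = 0 := by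
  let := HasDerivedCategory.standard C
  obtain ⟨P, p, hp, h⟩ := efface_Q (X := X) (i := 0)
    (L := (CochainComplex.singleFunctor C (-(n + 1))).obj Y)
    (e.hom ≫ ((singleFunctors C).shiftIso (n + 1) (-(n + 1)) 0 (by lia)).hom.app _)
    (n := -(n + 1)) (by lia)
  refine ⟨P, p, hp, ?_⟩
  ext
  rw [← cancel_mono (((singleFunctors C).shiftIso (n + 1) (-(n + 1)) 0
    (by lia)).hom.app _)]
  simp only [comp_hom, mk₀_hom, zero_hom, Limits.zero_comp, ShiftedHom.mk₀_comp]
  rw [Category.assoc]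
  exact h

lemma efface_ses [HasExt.{w} C] {X Y : C} {n m : ℕ} (e : Ext X Y m) (hm : 1 + n = m) :
    ∃ (K D : C) (i : K ⟶ D) (p : D ⟶ X) (w : i ≫ p = 0)
      (hS : (ShortComplex.mk i p w).ShortExact) (x : Ext K Y n), hS.extClass.comp x hm = e := by
  obtain rfl : n + 1 = m := by omega
  obtain ⟨P, p, hp, h⟩ := efface e
  have hS : (ShortComplex.mk (kernel.ι p) p (kernel.condition p)).ShortExact :=
    { exact := ShortComplex.exact_kernel p }
  obtain ⟨x, hx⟩ := contravariant_sequence_exact₃ hS _ e h hm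
  exact ⟨_, _, _, _, _, hS, x, hx⟩
end efface

section ses
variable {C : Type u} [Category.{v} C] [Abelian C]

lemma ses_pullback {K D A A₁ : C} {i : K ⟶ D} {p : D ⟶ A} {w : i ≫ p = 0}
    (hS : (ShortComplex.mk i p w).ShortExact) (f : A₁ ⟶ A) :
    ∃ (i' : K ⟶ pullback p f) (w' : i' ≫ pullback.snd p f = 0),
      (ShortComplex.mk i' (pullback.snd p f) w').ShortExact ∧ i' ≫ pullback.fst p f = i := by
  have := hS.mono_f
  have := hS.epi_g
  dsimp at *
  obtain ⟨l, hl1, hl2⟩ : ∃ l : K ⟶ pullback p f, l ≫ pullback.fst p f = i ∧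
      l ≫ pullback.snd p f = 0 :=
    ⟨pullback.lift i 0 (by rw [w, zero_comp]), pullback.lift_fst _ _ _, pullback.lift_snd _ _ _⟩
  refine ⟨l, hl2, ?_, hl1⟩
  have hm : Mono l := mono_of_mono_fac hl1
  refine { exact := ?_, mono_f := hm, epi_g := by dsimp; infer_instance }
  refine ShortComplex.exact_of_f_is_kernel _ (KernelFork.IsLimit.ofι' _ _ fun {Z} k hk => ?_)
  dsimp at k hk
  have h1 : (k ≫ pullback.fst p f) ≫ p = 0 := by
    rw [Category.assoc, pullback.condition, ← Category.assoc, hk, zero_comp]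
  refine ⟨hS.exact.lift (k ≫ pullback.fst p f) h1, ?_⟩
  have := hS.exact.lift_f (k ≫ pullback.fst p f) h1
  dsimp at this ⊢
  apply pullback.hom_ext
  · rw [Category.assoc, hl1]; exact this
  · rw [Category.assoc, hl2, hk, comp_zero]

lemma ses_pushout {K D A K₁ : C} {i : K ⟶ D} {p : D ⟶ A} {w : i ≫ p = 0}
    (hS : (ShortComplex.mk i p w).ShortExact) (f : K ⟶ K₁) :
    ∃ (p' : pushout i f ⟶ A) (w' : pushout.inr i f ≫ p' = 0),
      (ShortComplex.mk (pushout.inr i f) p' w').ShortExact ∧ pushout.inl i f ≫ p' = p := by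
  have := hS.mono_f
  have := hS.epi_g
  dsimp at *
  obtain ⟨l, hl1, hl2⟩ : ∃ l : pushout i f ⟶ A, pushout.inl i f ≫ l = p ∧
      pushout.inr i f ≫ l = 0 :=
    ⟨pushout.desc p 0 (by rw [w, comp_zero]), pushout.inl_desc _ _ _, pushout.inr_desc _ _ _⟩
  refine ⟨l, hl2, ?_, hl1⟩
  have hm : Epi l := epi_of_epi_fac hl1
  refine { exact := ?_, mono_f := by dsimp; infer_instance, epi_g := hm }
  refine ShortComplex.exact_of_g_is_cokernel _ (CokernelCofork.IsColimit.ofπ' _ _ fun {Z} k hk => ?_)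
  dsimp at k hk
  have h1 : i ≫ (pushout.inl i f ≫ k) = 0 := by
    rw [← Category.assoc, pushout.condition, Category.assoc, hk, comp_zero]
  refine ⟨hS.exact.desc (pushout.inl i f ≫ k) h1, ?_⟩
  have := hS.exact.g_desc (pushout.inl i f ≫ k) h1
  dsimp at this ⊢
  apply pushout.hom_ext
  · rw [← Category.assoc, hl1]; exact this
  · rw [← Category.assoc, hl2, hk, zero_comp]

lemma ses_biprod {K D A K₁ D₁ A₁ : C} {i : K ⟶ D} {p : D ⟶ A} {w : i ≫ p = 0}
    (hS : (ShortComplex.mk i p w).ShortExact) {i₁ : K₁ ⟶ D₁} {p₁ : D₁ ⟶ A₁} {w₁ : i₁ ≫ p₁ = 0}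
    (hS₁ : (ShortComplex.mk i₁ p₁ w₁).ShortExact) :
    ∃ (w' : biprod.map i i₁ ≫ biprod.map p p₁ = 0),
      (ShortComplex.mk (biprod.map i i₁) (biprod.map p p₁) w').ShortExact := by
  have := hS.mono_f
  have := hS.epi_g
  have := hS₁.mono_f
  have := hS₁.epi_g
  dsimp at *
  refine ⟨by ext <;> simp [w, w₁], ?_⟩
  refine { exact := ?_, mono_f := by dsimp; infer_instance, epi_g := by dsimp; infer_instance }
  refine ShortComplex.exact_of_f_is_kernel _ (KernelFork.IsLimit.ofι' _ _ fun {Z} k hk => ?_)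
  dsimp at k hk
  have h1 : (k ≫ biprod.fst) ≫ p = 0 := by
    have := hk =≫ biprod.fst
    simpa using this
  have h2 : (k ≫ biprod.snd) ≫ p₁ = 0 := by
    have := hk =≫ biprod.snd
    simpa using this
  refine ⟨biprod.lift (hS.exact.lift _ h1) (hS₁.exact.lift _ h2), ?_⟩
  have e1 := hS.exact.lift_f _ h1
  have e2 := hS₁.exact.lift_f _ h2
  dsimp at e1 e2 ⊢
  apply biprod.hom_ext
  · simpa using e1
  · simpa using e2

end ses

section alg
lemma equiv_of_rel {Y X : Type*} [AddCommGroup Y] [AddCommGroup X] (R : Y → X → Prop)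
    (hadd : ∀ y x y' x', R y x → R y' x' → R (y + y') (x + x'))
    (hneg : ∀ y x, R y x → R (-y) (-x))
    (hl : ∀ y, ∃ x, R y x) (hr : ∀ x, ∃ y, R y x)
    (h0 : ∀ x, R 0 x → x = 0) (h0' : ∀ y, R y 0 → y = 0) :
    ∃ e : Y ≃+ X, ∀ y, R y (e y) := by
  have hu : ∀ y x x', R y x → R y x' → x = x' := fun y x x' h h' => by
    have := hadd _ _ _ _ h (hneg _ _ h')
    rw [add_neg_cancel] at this
    exact add_neg_eq_zero.1 (h0 _ this)
  have hu' : ∀ y y' x, R y x → R y' x → y = y' := fun y y' x h h' => by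
    have := hadd _ _ _ _ h (hneg _ _ h')
    rw [add_neg_cancel] at this
    exact add_neg_eq_zero.1 (h0' _ this)
  choose f hf using hl
  choose g hg using hr
  exact ⟨{ toFun := f, invFun := g,
           left_inv := fun y => hu' _ _ _ (hg _) (hf _)
           right_inv := fun x => hu _ _ _ (hf _) (hg _)
           map_add' := fun y y' => hu _ _ _ (hf _) (hadd _ _ _ _ (hf _) (hf _)) }, hf⟩
end alg

section step
open Abelian Abelian.Ext
variable [Abelian A'] [Abelian B'] [HasExt.{w₁} A'] [HasExt.{w₂} B']
  (F : A' ⥤ B') (B : B') (Y : A') 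

/-- naturality of a family of isomorphisms -/
def IsNat {n : ℕ} (φ : ∀ K : A', Ext (F.obj K) B n ≃+ Ext K Y n) : Prop :=
  ∀ (K K' : A') (f : K ⟶ K') (y : Ext (F.obj K') B n),
    φ K ((mk₀ (F.map f)).comp y (zero_add n)) = (mk₀ f).comp (φ K' y) (zero_add n)

/-- the relation defining the next isomorphism -/
def Rel {n : ℕ} (φ : ∀ K : A', Ext (F.obj K) B n ≃+ Ext K Y n) (A : A')
    (y : Ext (F.obj A) B (1 + n)) (x : Ext A Y (1 + n)) : Prop :=
  ∃ (K D : A') (i : K ⟶ D) (p : D ⟶ A) (w : i ≫ p = 0) (w' : F.map i ≫ F.map p = 0)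
    (hS : (ShortComplex.mk i p w).ShortExact)
    (hFS : (ShortComplex.mk (F.map i) (F.map p) w').ShortExact) (y' : Ext (F.obj K) B n),
    y = hFS.extClass.comp y' rfl ∧ x = hS.extClass.comp (φ K y') rfl

variable {F B Y}

lemma map_ses [F.Additive] [PreservesFiniteColimits F] {K D A : A'} {i : K ⟶ D} {p : D ⟶ A}
    {w : i ≫ p = 0} (hS : (ShortComplex.mk i p w).ShortExact) (hm : Mono (F.map i)) :
    ∃ (w' : F.map i ≫ F.map p = 0), (ShortComplex.mk (F.map i) (F.map p) w').ShortExact := by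
  have w' : F.map i ≫ F.map p = 0 := by rw [← F.map_comp, w, F.map_zero]
  have := hS.epi_g
  dsimp at this
  exact ⟨w', { exact := hS.exact.map_of_epi_of_preservesCokernel F ‹_› inferInstance
               mono_f := hm
               epi_g := by dsimp; infer_instance }⟩

variable {n : ℕ} {φ : ∀ K : A', Ext (F.obj K) B n ≃+ Ext K Y n}

lemma Rel.neg {A : A'} {y x} (h : Rel F B Y φ A y x) : Rel F B Y φ A (-y) (-x) := by
  obtain ⟨K, D, i, p, w, w', hS, hFS, y', rfl, rfl⟩ := h
  exact ⟨K, D, i, p, w, w', hS, hFS, -y', by simp, by simp⟩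

lemma Rel.pull [F.Additive] [PreservesFiniteColimits F] {A A₁ : A'} (f : A₁ ⟶ A) {y x}
    (h : Rel F B Y φ A y x) :
    Rel F B Y φ A₁ ((mk₀ (F.map f)).comp y (zero_add _)) ((mk₀ f).comp x (zero_add _)) := by
  obtain ⟨K, D, i, p, w, w', hS, hFS, y', rfl, rfl⟩ := h
  obtain ⟨i₁, w₁, hS₁, hi⟩ := ses_pullback hS f
  have hm : Mono (F.map i₁) := by
    have := hFS.mono_f
    dsimp at this
    have e : F.map i₁ ≫ F.map (pullback.fst p f) = F.map i := by rw [← F.map_comp, hi]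
    exact mono_of_mono_fac e
  obtain ⟨w₂, hFS₁⟩ := map_ses (F := F) hS₁ hm
  refine ⟨K, _, i₁, _, w₁, w₂, hS₁, hFS₁, y', ?_, ?_⟩
  · have := ShortComplex.ShortExact.extClass_naturality hFS₁ hFS
      { τ₁ := 𝟙 _, τ₂ := F.map (pullback.fst p f), τ₃ := F.map f
        comm₁₂ := by dsimp; rw [← F.map_comp, hi]; simp
        comm₂₃ := by dsimp; rw [← F.map_comp, ← F.map_comp, pullback.condition] }
    dsimp at this
    rw [comp_mk₀_id] at this
    rw [this, comp_assoc]
    omega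
  · have := ShortComplex.ShortExact.extClass_naturality hS₁ hS
      { τ₁ := 𝟙 _, τ₂ := (pullback.fst p f), τ₃ := f
        comm₁₂ := by dsimp; rw [hi]; simp
        comm₂₃ := by dsimp; rw [pullback.condition] }
    dsimp at this
    rw [comp_mk₀_id] at this
    rw [this, comp_assoc]
    omega

lemma Rel.biprod [F.Additive] [PreservesFiniteColimits F] (hφ : IsNat F B Y φ) {A A₁ : A'} {y x}
    (h : Rel F B Y φ A y x) {y₁ x₁} (h₁ : Rel F B Y φ A₁ y₁ x₁) :
    Rel F B Y φ (A ⊞ A₁)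
      ((mk₀ (F.map biprod.fst)).comp y (zero_add _) + (mk₀ (F.map biprod.snd)).comp y₁ (zero_add _))
      ((mk₀ biprod.fst).comp x (zero_add _) + (mk₀ biprod.snd).comp x₁ (zero_add _)) := by
  obtain ⟨K, D, i, p, w, w', hS, hFS, y', rfl, rfl⟩ := h
  obtain ⟨K₁, D₁, i₁, p₁, w₁, w₁', hS₁, hFS₁, y₁', rfl, rfl⟩ := h₁
  obtain ⟨w₂, hS₂⟩ := ses_biprod hS hS₁
  have hm : Mono (F.map (biprod.map i i₁)) := by
    have m1 := hFS.mono_f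
    have m2 := hFS₁.mono_f
    dsimp at m1 m2
    refine Preadditive.mono_of_cancel_zero _ fun {Z} z hz => ?_
    have e1 : z ≫ F.map biprod.fst = 0 := by
      rw [← cancel_mono (F.map i), Category.assoc, ← F.map_comp, ← biprod.map_fst i i₁,
        F.map_comp, reassoc_of% hz]
      simp
    have e2 : z ≫ F.map biprod.snd = 0 := by
      rw [← cancel_mono (F.map i₁), Category.assoc, ← F.map_comp, ← biprod.map_snd i i₁,
        F.map_comp, reassoc_of% hz]
      simp
    have : z = z ≫ F.map (biprod.fst ≫ biprod.inl + biprod.snd ≫ biprod.inr) := by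
      rw [biprod.total, F.map_id, Category.comp_id]
    rw [this, F.map_add, F.map_comp, F.map_comp, Preadditive.comp_add, reassoc_of% e1,
      reassoc_of% e2]
    simp
  obtain ⟨w₂', hFS₂⟩ := map_ses (F := F) hS₂ hm
  refine ⟨_, _, _, _, w₂, w₂', hS₂, hFS₂,
    (mk₀ (F.map biprod.fst)).comp y' (zero_add _) + (mk₀ (F.map biprod.snd)).comp y₁' (zero_add _),
    ?_, ?_⟩
  · have e1 := ShortComplex.ShortExact.extClass_naturality hFS₂ hFS
      { τ₁ := F.map biprod.fst, τ₂ := F.map biprod.fst, τ₃ := F.map biprod.fst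
        comm₁₂ := by dsimp; rw [← F.map_comp, ← F.map_comp, biprod.map_fst]
        comm₂₃ := by dsimp; rw [← F.map_comp, ← F.map_comp, biprod.map_fst] }
    have e2 := ShortComplex.ShortExact.extClass_naturality hFS₂ hFS₁
      { τ₁ := F.map biprod.snd, τ₂ := F.map biprod.snd, τ₃ := F.map biprod.snd
        comm₁₂ := by dsimp; rw [← F.map_comp, ← F.map_comp, biprod.map_snd]
        comm₂₃ := by dsimp; rw [← F.map_comp, ← F.map_comp, biprod.map_snd] }
    dsimp at e1 e2
    rw [comp_add, ← comp_assoc_of_second_deg_zero, ← comp_assoc_of_second_deg_zero, e1, e2,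
      comp_assoc, comp_assoc] <;> omega
  · have e1 := ShortComplex.ShortExact.extClass_naturality hS₂ hS
      { τ₁ := biprod.fst, τ₂ := biprod.fst, τ₃ := biprod.fst }
    have e2 := ShortComplex.ShortExact.extClass_naturality hS₂ hS₁
      { τ₁ := biprod.snd, τ₂ := biprod.snd, τ₃ := biprod.snd }
    dsimp at e1 e2
    rw [map_add, hφ, hφ, comp_add, ← comp_assoc_of_second_deg_zero,
      ← comp_assoc_of_second_deg_zero, e1, e2,
      comp_assoc, comp_assoc] <;> omega

lemma Rel.add [F.Additive] [PreservesFiniteColimits F] (hφ : IsNat F B Y φ) {A : A'} {y x}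
    (h : Rel F B Y φ A y x) {y₁ x₁} (h₁ : Rel F B Y φ A y₁ x₁) :
    Rel F B Y φ A (y + y₁) (x + x₁) := by
  have := (h.biprod hφ h₁).pull (biprod.lift (𝟙 A) (𝟙 A))
  simpa [comp_add, ← F.map_comp] using this

lemma Rel.zero_left (hφ : IsNat F B Y φ) {A : A'} {x} (h : Rel F B Y φ A 0 x) : x = 0 := by
  obtain ⟨K, D, i, p, w, w', hS, hFS, y', h0, rfl⟩ := h
  obtain ⟨z, hz⟩ := contravariant_sequence_exact₁ hFS _ y' rfl h0.symm
  dsimp at z hz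
  rw [← hz, hφ]
  exact hS.extClass_comp_assoc _

lemma Rel.zero_right (hφ : IsNat F B Y φ) {A : A'} {y} (h : Rel F B Y φ A y 0) : y = 0 := by
  obtain ⟨K, D, i, p, w, w', hS, hFS, y', rfl, h0⟩ := h
  obtain ⟨z, hz⟩ := contravariant_sequence_exact₁ hS _ (φ K y') rfl h0.symm
  dsimp at z hz
  have : y' = (mk₀ (F.map i)).comp ((φ D).symm z) (zero_add _) := by
    apply (φ K).injective
    rw [hφ, ← hz]
    simp
  rw [this]
  exact hFS.extClass_comp_assoc _

lemma step [F.Additive] [PreservesFiniteColimits F] (hφ : IsNat F B Y φ) (A : A')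
    (hl : ∀ y, ∃ x, Rel F B Y φ A y x) (hr : ∀ x, ∃ y, Rel F B Y φ A y x) :
    ∃ e : Ext (F.obj A) B (1 + n) ≃+ Ext A Y (1 + n), ∀ y, Rel F B Y φ A y (e y) :=
  equiv_of_rel _ (fun _ _ _ _ h h' => h.add hφ h') (fun _ _ h => h.neg) hl hr
    (fun _ h => h.zero_left hφ) (fun _ h => h.zero_right hφ)

lemma step_nat [F.Additive] [PreservesFiniteColimits F] (hφ : IsNat F B Y φ)
    (hl : ∀ A y, ∃ x, Rel F B Y φ A y x) (hr : ∀ A x, ∃ y, Rel F B Y φ A y x) :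
    ∃ e : ∀ A, Ext (F.obj A) B (1 + n) ≃+ Ext A Y (1 + n), IsNat F B Y e := by
  choose e he using fun A => step hφ A (hl A) (hr A)
  refine ⟨e, fun K K' f y => ?_⟩
  have h1 := he K ((mk₀ (F.map f)).comp y (zero_add _))
  have h2 := (he K' y).pull f
  have h3 := (h1.add hφ h2.neg)
  rw [add_neg_cancel] at h3
  exact add_neg_eq_zero.1 (h3.zero_left hφ)

lemma Rel.of_right {A K D : A'} [F.Additive] [PreservesFiniteColimits F]
    {i : K ⟶ D} {p : D ⟶ A} {w : i ≫ p = 0}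
    (hS : (ShortComplex.mk i p w).ShortExact) (hm : Mono (F.map i)) (x : Ext K Y n) :
    ∃ y, Rel F B Y φ A y (hS.extClass.comp x rfl) := by
  obtain ⟨w', hFS⟩ := map_ses (F := F) hS hm
  exact ⟨_, K, D, i, p, w, w', hS, hFS, (φ K).symm x, rfl, by simp⟩

lemma hr_all [F.Additive] [PreservesFiniteColimits F] (A : A')
    (hF : ∀ (K D : A') (i : K ⟶ D) (p : D ⟶ A) (w : i ≫ p = 0),
      (ShortComplex.mk i p w).ShortExact → Mono (F.map i)) (x) :
    ∃ y, Rel F B Y φ A y x := by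
  obtain ⟨K, D, i, p, w, hS, x', rfl⟩ := efface_ses x rfl
  exact Rel.of_right hS (hF _ _ _ _ _ hS) x'

lemma exists_ses_one {C : Type u} [Category.{v} C] [Abelian C] [HasExt.{w} C] {X Z : C}
    (x : Ext X Z (1 + 0)) :
    ∃ (D : C) (i : Z ⟶ D) (p : D ⟶ X) (w : i ≫ p = 0)
      (hS : (ShortComplex.mk i p w).ShortExact), hS.extClass.comp (mk₀ (𝟙 _)) rfl = x := by
  obtain ⟨K, D, i, p, w, hS, x', rfl⟩ := efface_ses x rfl
  obtain ⟨k, rfl⟩ := mk₀_bijective _ _ |>.2 x'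
  obtain ⟨p', w', hS', h⟩ := ses_pushout hS k
  refine ⟨_, _, p', w', hS', ?_⟩
  have := ShortComplex.ShortExact.extClass_naturality hS hS'
    { τ₁ := k, τ₂ := pushout.inl i k, τ₃ := 𝟙 _
      comm₁₂ := by dsimp; rw [pushout.condition]
      comm₂₃ := by dsimp; rw [h]; simp }
  dsimp at this
  rw [mk₀_id_comp] at this
  rw [this]
  exact comp_mk₀_id _

lemma hr_one [F.Additive] [PreservesFiniteColimits F] 
    {φ : ∀ K : A', Ext (F.obj K) B 0 ≃+ Ext K Y 0} (A : A')
    (hF : ∀ (D : A') (i : Y ⟶ D) (p : D ⟶ A) (w : i ≫ p = 0),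
      (ShortComplex.mk i p w).ShortExact → Mono (F.map i)) (x) :
    ∃ y, Rel F B Y φ A y x := by
  obtain ⟨D, i, p, w, hS, rfl⟩ := exists_ses_one x
  exact Rel.of_right hS (hF _ _ _ _ hS) _

lemma Rel.of_left [F.Additive] [PreservesFiniteColimits F] {G : B' ⥤ A'} (adj : F ⊣ G)
    {A K D : A'} {i : K ⟶ D} {p : D ⟶ A} {w : i ≫ p = 0}
    (hS : (ShortComplex.mk i p w).ShortExact) (hm : Mono (F.map i))
    {M E : B'} {j : M ⟶ E} {q : E ⟶ F.obj A} {wT : j ≫ q = 0}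
    (hT : (ShortComplex.mk j q wT).ShortExact) (d : D ⟶ G.obj E)
    (hd : d ≫ G.map q = p ≫ adj.unit.app A) (z : Ext M B n) :
    ∃ x, Rel F B Y φ A (hT.extClass.comp z rfl) x := by
  obtain ⟨w', hFS⟩ := map_ses (F := F) hS hm
  have e2 : (adj.homEquiv _ _).symm d ≫ q = F.map p := by
    rw [← adj.homEquiv_naturality_right_symm, hd]
    simp [Adjunction.homEquiv_counit]
  have e0 : (F.map i ≫ (adj.homEquiv _ _).symm d) ≫ q = 0 := by
    rw [Category.assoc, e2, w']
  have := hT.mono_f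
  have e1 := hT.exact.lift_f _ e0
  dsimp at e1
  have nat := ShortComplex.ShortExact.extClass_naturality hFS hT
    { τ₁ := hT.exact.lift _ e0, τ₂ := (adj.homEquiv _ _).symm d, τ₃ := 𝟙 _
      comm₁₂ := e1
      comm₂₃ := by dsimp; rw [e2]; simp }
  dsimp at nat
  rw [mk₀_id_comp] at nat
  refine ⟨_, K, D, i, p, w, w', hS, hFS, (mk₀ (hT.exact.lift _ e0)).comp z (zero_add _), ?_, rfl⟩
  rw [← nat, comp_assoc_of_second_deg_zero]

lemma hl_all [F.Additive] [PreservesFiniteColimits F] {G : B' ⥤ A'} (adj : F ⊣ G) (A : A')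
    (hF : ∀ (K D : A') (i : K ⟶ D) (p : D ⟶ A) (w : i ≫ p = 0),
      (ShortComplex.mk i p w).ShortExact → Mono (F.map i))
    (hG : ∀ (K D : B') (i : K ⟶ D) (p : D ⟶ F.obj A) (w : i ≫ p = 0),
      (ShortComplex.mk i p w).ShortExact → Epi (G.map p)) (y) :
    ∃ x, Rel F B Y φ A y x := by
  obtain ⟨M, E, j, q, wT, hT, z, rfl⟩ := efface_ses y rfl
  have := hG _ _ _ _ _ hT
  have hS : (ShortComplex.mk (kernel.ι (pullback.snd (G.map q) (adj.unit.app A)))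
    (pullback.snd (G.map q) (adj.unit.app A)) (kernel.condition _)).ShortExact :=
    { exact := ShortComplex.exact_kernel _
      mono_f := by dsimp; infer_instance
      epi_g := by dsimp; infer_instance }
  exact Rel.of_left adj hS (hF _ _ _ _ _ hS) hT (pullback.fst _ _) pullback.condition z

lemma hl_one [F.Additive] [PreservesFiniteColimits F] {G : B' ⥤ A'} [G.Additive]
    [PreservesFiniteLimits G] (adj : F ⊣ G)
    {φ : ∀ K : A', Ext (F.obj K) B 0 ≃+ Ext K (G.obj B) 0} (A : A')
    (hF : ∀ (D : A') (i : G.obj B ⟶ D) (p : D ⟶ A) (w : i ≫ p = 0),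
      (ShortComplex.mk i p w).ShortExact → Mono (F.map i))
    (hG : ∀ (D : B') (i : B ⟶ D) (p : D ⟶ F.obj A) (w : i ≫ p = 0),
      (ShortComplex.mk i p w).ShortExact → Epi (G.map p)) (y) :
    ∃ x, Rel F B (G.obj B) φ A y x := by
  obtain ⟨E, j, q, wT, hT, rfl⟩ := exists_ses_one y
  have h1 := hG _ _ _ _ hT
  have h2 := hT.mono_f
  dsimp at h2
  have hGT : (ShortComplex.mk (G.map j) (G.map q)
      (by rw [← G.map_comp, wT, G.map_zero])).ShortExact :=
    { exact := hT.exact.map_of_mono_of_preservesKernel G h2 inferInstance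
      mono_f := by dsimp; infer_instance
      epi_g := h1 }
  obtain ⟨i, w, hS, hi⟩ := ses_pullback hGT (adj.unit.app A)
  exact Rel.of_left adj hS (hF _ _ _ _ hS) hT (pullback.fst _ _) pullback.condition _

/-- existence of natural isomorphisms in degree `n` -/
def Lvl (F : A' ⥤ B') (B : B') (Y : A') (n : ℕ) : Prop :=
  ∃ φ : ∀ K : A', Ext (F.obj K) B n ≃+ Ext K Y n, IsNat F B Y φ

lemma lvl_zero [F.Additive] {G : B' ⥤ A'} [G.Additive] (adj : F ⊣ G) : Lvl F B (G.obj B) 0 := by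
  refine ⟨fun K => (addEquiv₀.trans (adj.homAddEquiv K B)).trans addEquiv₀.symm, fun K K' f y => ?_⟩
  obtain ⟨k, rfl⟩ := mk₀_bijective _ _ |>.2 y
  have h : ∀ (X : A') (g : F.obj X ⟶ B), addEquiv₀ (mk₀ g) = g := fun X g =>
    addEquiv₀.symm_apply_eq.1 rfl |>.symm
  have h' : ∀ (X : A') (g : X ⟶ G.obj B), addEquiv₀.symm g = mk₀ g := fun X g => rfl
  simp [h, h', Adjunction.homEquiv_naturality_left]

end step

section arrows
open ComposableArrows

section
variable {C : Type u} [Category.{v} C] [Abelian C]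

lemma exact_iff' {k : ℕ} (S : ComposableArrows C (k + 2)) :
    S.Exact ↔ (∃ w : S.map' 0 1 ≫ S.map' 1 2 = 0,
      (ShortComplex.mk (S.map' 0 1) (S.map' 1 2) w).Exact) ∧ S.δ₀.Exact := by
  rw [exact_iff_δ₀]
  refine and_congr_left fun _ => ⟨fun h => ⟨h.toIsComplex.zero 0, h.exact 0⟩, ?_⟩
  rintro ⟨w, h⟩
  exact exact₂_mk _ w h

variable {Y P X₀ X₁ X₂ : C} {a : Y ⟶ P} {t : P ⟶ Y} {s : P ⟶ X₀} {r : X₀ ⟶ P}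

lemma bi_exact (f : X₀ ⟶ X₁) [Mono f] (has : a ≫ s = 0) (hat : a ≫ t = 𝟙 _)
    (htot : t ≫ a + s ≫ r = 𝟙 _) :
    ∃ w : a ≫ (s ≫ f) = 0, (ShortComplex.mk a (s ≫ f) w).Exact := by
  have w : a ≫ (s ≫ f) = 0 := by rw [← Category.assoc, has, zero_comp]
  have : Mono a := mono_of_mono_fac hat
  refine ⟨w, ShortComplex.exact_of_f_is_kernel _
    (KernelFork.IsLimit.ofι' _ _ fun {Z} k hk => ⟨k ≫ t, ?_⟩)⟩
  dsimp at k hk ⊢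
  have h1 : k ≫ s = 0 := by
    rw [← cancel_mono f, Category.assoc, hk, zero_comp]
  have := k ≫= htot
  rw [Preadditive.comp_add, reassoc_of% h1, zero_comp, add_zero, Category.comp_id] at this
  rw [Category.assoc, this]

lemma bi_mono (f : X₀ ⟶ X₁) (has : a ≫ s = 0) (hat : a ≫ t = 𝟙 _) (hrs : r ≫ s = 𝟙 _)
    (w : a ≫ (s ≫ f) = 0) (h : (ShortComplex.mk a (s ≫ f) w).Exact) : Mono f := by
  have : Mono (ShortComplex.mk a (s ≫ f) w).f := mono_of_mono_fac hat
  refine Preadditive.mono_of_cancel_zero _ fun {Z} z hz => ?_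
  have h0 : (z ≫ r) ≫ (ShortComplex.mk a (s ≫ f) w).g = 0 := by
    dsimp
    rw [Category.assoc, reassoc_of% hrs, hz]
  have h1 := h.lift_f (z ≫ r) h0
  have h2 := h1 =≫ s
  dsimp at h2
  rw [Category.assoc, Category.assoc, has, comp_zero, hrs, Category.comp_id] at h2
  exact h2.symm

lemma bi_iff (f : X₀ ⟶ X₁) (g : X₁ ⟶ X₂) (hrs : r ≫ s = 𝟙 _) :
    (∃ w : f ≫ g = 0, (ShortComplex.mk f g w).Exact) ↔
    (∃ w : (s ≫ f) ≫ g = 0, (ShortComplex.mk (s ≫ f) g w).Exact) := by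
  have : Epi s := epi_of_epi_fac hrs
  have key : ∀ (w : f ≫ g = 0) (w' : (s ≫ f) ≫ g = 0),
      (ShortComplex.mk (s ≫ f) g w').Exact ↔ (ShortComplex.mk f g w).Exact := fun w w' => by
    let α : ShortComplex.mk (s ≫ f) g w' ⟶ ShortComplex.mk f g w :=
      { τ₁ := s, τ₂ := 𝟙 _, τ₃ := 𝟙 _ }
    have : Epi α.τ₁ := by dsimp [α]; infer_instance
    have : IsIso α.τ₂ := by dsimp [α]; infer_instance
    have : Mono α.τ₃ := by dsimp [α]; infer_instance
    exact ShortComplex.exact_iff_of_epi_of_isIso_of_mono α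
  constructor
  · rintro ⟨w, h⟩
    have w' : (s ≫ f) ≫ g = 0 := by rw [Category.assoc, w, comp_zero]
    exact ⟨w', (key w w').2 h⟩
  · rintro ⟨w', h⟩
    have w : f ≫ g = 0 := by
      rw [← cancel_epi s, ← Category.assoc, w', comp_zero]
    exact ⟨w, (key w w').1 h⟩
end

variable {C : Type u₁} [Category.{v₁} C] [Abelian C] {D : Type u₂} [Category.{v₂} D] [Abelian D]
  (H : C ⥤ D) [H.Additive]

lemma red {k : ℕ} (Y A : C)
    (h : ∀ S : ComposableArrows C (k + 2 + 1), S.obj' 0 = Y → S.obj' (k + 2 + 1) = A →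
      ExactWithZeros S → ExactWithZeros ((H.mapComposableArrows (k + 2 + 1)).obj S)) :
    ∀ S : ComposableArrows C (k + 1 + 1), S.obj' (k + 1 + 1) = A →
      ExactWithZeros S → ExactWithZeros ((H.mapComposableArrows (k + 1 + 1)).obj S) := by
  rintro S hA ⟨hS, hm, he⟩
  let f : S.obj' 0 ⟶ S.obj' 1 := S.map' 0 1
  let T : ComposableArrows C (k + 2) := S.δ₀.precomp (X := Y ⊞ S.obj' 0) (biprod.snd ≫ f)
  let S' : ComposableArrows C (k + 3) := T.precomp (X := Y) biprod.inl
  rw [exact_iff'] at hS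
  have hS' : ExactWithZeros S' := by
    refine ⟨?_, ?_, he⟩
    · rw [exact_iff']
      refine ⟨bi_exact (a := (biprod.inl : Y ⟶ Y ⊞ S.obj' 0)) (s := biprod.snd) (t := biprod.fst)
        (r := biprod.inr) f biprod.inl_snd biprod.inl_fst biprod.total, ?_⟩
      change T.Exact
      rw [exact_iff']
      exact ⟨(bi_iff (s := (biprod.snd : Y ⊞ S.obj' 0 ⟶ _)) (r := biprod.inr) f (S.map' 1 2)
        (by simp)).1 hS.1, hS.2⟩
    · change Mono (biprod.inl : Y ⟶ Y ⊞ S.obj' 0)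
      infer_instance
  obtain ⟨e1, e2, e3⟩ := h S' rfl hA hS'
  rw [exact_iff'] at e1
  obtain ⟨⟨w, e1⟩, e4⟩ := e1
  change ((H.mapComposableArrows (k + 2)).obj T).Exact at e4
  rw [exact_iff'] at e4
  obtain ⟨e4, e5⟩ := e4
  have ms : H.map (biprod.snd ≫ f) = H.map (biprod.snd : Y ⊞ S.obj' 0 ⟶ _) ≫ H.map f :=
    H.map_comp _ _
  have hrs : H.map (biprod.inr : S.obj' 0 ⟶ Y ⊞ S.obj' 0) ≫ H.map biprod.snd = 𝟙 _ := by
    rw [← H.map_comp, biprod.inr_snd, H.map_id]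
  refine ⟨?_, ?_, e3⟩
  · rw [exact_iff']
    refine ⟨?_, e5⟩
    refine (bi_iff (H.map f) (H.map (S.map' 1 2)) hrs).2 ?_
    rw [← ms]
    exact e4
  · change Mono (H.map f)
    have key : ∃ w : H.map (biprod.inl : Y ⟶ Y ⊞ S.obj' 0) ≫ H.map (biprod.snd ≫ f) = 0,
      (ShortComplex.mk _ _ w).Exact := ⟨w, e1⟩
    rw [ms] at key
    obtain ⟨w, e1⟩ := key
    exact bi_mono (t := H.map biprod.fst) (H.map f)
      (by rw [← H.map_comp, biprod.inl_snd, H.map_zero])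
      (by rw [← H.map_comp, biprod.inl_fst, H.map_id]) hrs w e1

lemma red_iter (k : ℕ) (A : C)
    (h : ∀ S : ComposableArrows C (k + 2 + 1), S.obj' (k + 2 + 1) = A →
      ExactWithZeros S → ExactWithZeros ((H.mapComposableArrows (k + 2 + 1)).obj S)) :
    ∀ S : ComposableArrows C (2 + 1), S.obj' (2 + 1) = A →
      ExactWithZeros S → ExactWithZeros ((H.mapComposableArrows (2 + 1)).obj S) := by
  induction k with
  | zero => exact h
  | succ k ih => exact ih (red H (k := k + 1) A A fun S _ => h S)

lemma ses_two {K E A : C} {i : K ⟶ E} {p : E ⟶ A} {w : i ≫ p = 0}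
    (hS : (ShortComplex.mk i p w).ShortExact)
    (h : ∀ S : ComposableArrows C (1 + 1), S.obj' 0 = K → S.obj' (1 + 1) = A →
      ExactWithZeros S → ExactWithZeros ((H.mapComposableArrows (1 + 1)).obj S)) :
    Mono (H.map i) ∧ Epi (H.map p) := by
  obtain ⟨-, h2, h3⟩ := h (mk₂ i p) rfl rfl ⟨exact₂_mk _ w hS.exact, hS.mono_f, hS.epi_g⟩
  exact ⟨h2, h3⟩

lemma ses_three {K E M A : C} {i : K ⟶ E} {p : E ⟶ M} {w : i ≫ p = 0}
    (hS : (ShortComplex.mk i p w).ShortExact)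
    (h : ∀ S : ComposableArrows C (2 + 1), S.obj' 0 = K → S.obj' (2 + 1) = A →
      ExactWithZeros S → ExactWithZeros ((H.mapComposableArrows (2 + 1)).obj S)) :
    Mono (H.map i) ∧ Epi (H.map p) := by
  have mi := hS.mono_f
  have ep := hS.epi_g
  dsimp at mi ep
  have hex : ExactWithZeros (n := 2)
      (mk₃ i (p ≫ (biprod.inl : M ⟶ M ⊞ A)) (biprod.snd : M ⊞ A ⟶ A)) := by
    refine ⟨?_, mi, ?_⟩
    · rw [exact_iff']
      refine ⟨⟨?_, ?_⟩, exact₂_mk _ ?_ ?_⟩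
      · change i ≫ p ≫ (biprod.inl : M ⟶ M ⊞ A) = 0
        rw [← Category.assoc, w, zero_comp]
      · let α : ShortComplex.mk i p w ⟶ ShortComplex.mk i (p ≫ (biprod.inl : M ⟶ M ⊞ A))
            (by rw [← Category.assoc, w, zero_comp]) :=
          { τ₁ := 𝟙 _, τ₂ := 𝟙 _, τ₃ := biprod.inl }
        have : Epi α.τ₁ := by dsimp [α]; infer_instance
        have : IsIso α.τ₂ := by dsimp [α]; infer_instance
        have : Mono α.τ₃ := by dsimp [α]; infer_instance
        exact (ShortComplex.exact_iff_of_epi_of_isIso_of_mono α).1 hS.exact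
      · change (p ≫ (biprod.inl : M ⟶ M ⊞ A)) ≫ biprod.snd = 0
        simp
      · change (ShortComplex.mk (p ≫ (biprod.inl : M ⟶ M ⊞ A)) biprod.snd (by simp)).Exact
        let α : ShortComplex.mk (p ≫ (biprod.inl : M ⟶ M ⊞ A)) biprod.snd (by simp) ⟶
            ShortComplex.mk (biprod.inl : M ⟶ M ⊞ A) biprod.snd (by simp) :=
          { τ₁ := p, τ₂ := 𝟙 _, τ₃ := 𝟙 _ }
        have : Epi α.τ₁ := by dsimp [α]; infer_instance
        have : IsIso α.τ₂ := by dsimp [α]; infer_instance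
        have : Mono α.τ₃ := by dsimp [α]; infer_instance
        exact (ShortComplex.exact_iff_of_epi_of_isIso_of_mono α).2
          (ShortComplex.Splitting.ofHasBinaryBiproduct M A).exact
    · change Epi (biprod.snd : M ⊞ A ⟶ A)
      infer_instance
  obtain ⟨e1, e2, e3⟩ := h _ rfl rfl hex
  refine ⟨e2, ?_⟩
  rw [exact_iff'] at e1
  have e4 := e1.2
  rw [exact_iff'] at e4
  obtain ⟨⟨w', e4⟩, -⟩ := e4
  have key : ∃ w : H.map (p ≫ (biprod.inl : M ⟶ M ⊞ A)) ≫ H.map biprod.snd = 0,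
      (ShortComplex.mk _ _ w).Exact := ⟨w', e4⟩
  obtain ⟨w, e5⟩ := key
  have : Epi (ShortComplex.mk _ _ w).g := e3
  refine Preadditive.epi_of_cancel_zero _ fun {Z} z hz => ?_
  have h0 : (ShortComplex.mk _ _ w).f ≫ (H.map biprod.fst ≫ z) = 0 := by
    dsimp
    rw [← Category.assoc, ← H.map_comp, Category.assoc, biprod.inl_fst, Category.comp_id, hz]
  have h1 := H.map biprod.inl ≫= e5.g_desc _ h0
  dsimp at h1
  rw [← Category.assoc, ← Category.assoc, ← H.map_comp, ← H.map_comp, biprod.inl_snd,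
    biprod.inl_fst, H.map_zero, zero_comp, H.map_id, Category.id_comp] at h1
  exact h1.symm

end arrows
end AdjExt

/-- Let `F ⊣ G` be adjoint functors between abelian categories, `n ≥ 0`, `A ∈ 𝒜`, `B ∈ ℬ`.
If (1) `F` maps every exact sequence `0 → GB → D_1 → ⋯ → D_n → A → 0` to an exact
sequence `0 → FGB → FD_1 → ⋯ → FD_n → FA → 0`, and (2) `G` maps every exact sequence
`0 → B → E_1 → ⋯ → E_n → FA → 0` to an exact sequence `0 → GB → GE_1 → ⋯ → GE_n → GFA → 0`,
then `Ext^n_ℬ(FA, B) ≅ Ext^n_𝒜(A, GB)` as abelian groups. -/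
theorem stmt12 [Abelian A'] [Abelian B'] [HasExt.{w₁} A'] [HasExt.{w₂} B']
    (F : A' ⥤ B') (G : B' ⥤ A') (adj : F ⊣ G) (n : ℕ) (A : A') (B : B')
    (h1 : ∀ S : ComposableArrows A' (n + 1), S.obj' 0 = G.obj B → S.obj' (n + 1) = A →
      ExactWithZeros S → ExactWithZeros ((F.mapComposableArrows (n + 1)).obj S))
    (h2 : ∀ S : ComposableArrows B' (n + 1), S.obj' 0 = B → S.obj' (n + 1) = F.obj A →
      ExactWithZeros S → ExactWithZeros ((G.mapComposableArrows (n + 1)).obj S)) :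
    Nonempty (Abelian.Ext (F.obj A) B n ≃+ Abelian.Ext A (G.obj B) n) := by
  have : PreservesColimits F := adj.leftAdjoint_preservesColimits
  have : PreservesLimits G := adj.rightAdjoint_preservesLimits
  have : PreservesFiniteColimits F := inferInstance
  have : PreservesFiniteLimits G := inferInstance
  have : G.Additive := Functor.additive_of_preserves_binary_products G
  have : F.Additive := adj.left_adjoint_additive
  obtain ⟨φ, hφ⟩ := AdjExt.lvl_zero (B := B) adj
  match n, h1, h2 with
  | 0, _, _ => exact ⟨φ A⟩
  | 1, h1, h2 =>
    have hF : ∀ (D : A') (i : G.obj B ⟶ D) (p : D ⟶ A) (w : i ≫ p = 0),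
        (ShortComplex.mk i p w).ShortExact → Mono (F.map i) :=
      fun D i p w hS => (AdjExt.ses_two F hS h1).1
    have hG : ∀ (D : B') (i : B ⟶ D) (p : D ⟶ F.obj A) (w : i ≫ p = 0),
        (ShortComplex.mk i p w).ShortExact → Epi (G.map p) :=
      fun D i p w hS => (AdjExt.ses_two G hS h2).2
    obtain ⟨e, -⟩ := AdjExt.step hφ A (AdjExt.hl_one adj A hF hG) (AdjExt.hr_one A hF)
    exact ⟨e⟩
  | 2, h1, h2 =>
    have hF : ∀ (K D : A') (i : G.obj B ⟶ D) (p : D ⟶ K) (w : i ≫ p = 0),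
        (ShortComplex.mk i p w).ShortExact → Mono (F.map i) :=
      fun K D i p w hS => (AdjExt.ses_three F hS h1).1
    have hG : ∀ (K : A') (D : B') (i : B ⟶ D) (p : D ⟶ F.obj K) (w : i ≫ p = 0),
        (ShortComplex.mk i p w).ShortExact → Epi (G.map p) :=
      fun K D i p w hS => (AdjExt.ses_three G hS h2).2
    obtain ⟨ψ, hψ⟩ := AdjExt.step_nat hφ (fun K => AdjExt.hl_one adj K (hF K) (hG K))
      (fun K => AdjExt.hr_one K (hF K))
    have r1 := AdjExt.red F (k := 0) _ _ h1
    have r2 := AdjExt.red G (k := 0) _ _ h2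
    have hF' : ∀ (K D : A') (i : K ⟶ D) (p : D ⟶ A) (w : i ≫ p = 0),
        (ShortComplex.mk i p w).ShortExact → Mono (F.map i) :=
      fun K D i p w hS => (AdjExt.ses_two F hS (fun S _ => r1 S)).1
    have hG' : ∀ (K D : B') (i : K ⟶ D) (p : D ⟶ F.obj A) (w : i ≫ p = 0),
        (ShortComplex.mk i p w).ShortExact → Epi (G.map p) :=
      fun K D i p w hS => (AdjExt.ses_two G hS (fun S _ => r2 S)).2
    obtain ⟨e, -⟩ := AdjExt.step hψ A (AdjExt.hl_all adj A hF' hG') (AdjExt.hr_all A hF')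
    exact ⟨e⟩
  | k + 3, h1, h2 =>
    have r1 := AdjExt.red_iter F k _ (AdjExt.red F (k := k + 1) _ _ h1)
    have r2 := AdjExt.red_iter G k _ (AdjExt.red G (k := k + 1) _ _ h2)
    have hF : ∀ (X K D : A') (i : K ⟶ D) (p : D ⟶ X) (w : i ≫ p = 0),
        (ShortComplex.mk i p w).ShortExact → Mono (F.map i) :=
      fun X K D i p w hS => (AdjExt.ses_three F hS (fun S _ => r1 S)).1
    have hG : ∀ (X : A') (K D : B') (i : K ⟶ D) (p : D ⟶ F.obj X) (w : i ≫ p = 0),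
        (ShortComplex.mk i p w).ShortExact → Epi (G.map p) :=
      fun X K D i p w hS => (AdjExt.ses_three G hS (fun S _ => r2 S)).2
    have main : ∀ m : ℕ, AdjExt.Lvl F B (G.obj B) m := by
      intro m
      induction m with
      | zero => exact ⟨φ, hφ⟩
      | succ m ih =>
        obtain ⟨ψ, hψ⟩ := ih
        rw [Nat.add_comm]
        exact AdjExt.step_nat hψ (fun K => AdjExt.hl_all adj K (hF K) (hG K))
          (fun K => AdjExt.hr_all K (hF K))
    obtain ⟨ψ, -⟩ := main (k + 3)
    exact ⟨ψ A⟩
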